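/- Let X be a first countable, locally compact, paracompact Hausdorff topological space, f : X → X a topologically expansive homeomorphism, B a proper expansive neighborhood for f, and x ∈ X a periodic point of f. Then W^s_B(x) ⊆ W^s(x) and W^u_B(x) ⊆ W^u(x). -/

import Mathlib

open Set Topology

namespace TopAnosovPaper

variable {X Y : Type*}

section Defs

variable [TopologicalSpace X]

/-- The `n`-th iterate (n ∈ ℤ) of a homeomorphism, as a function. -/
def iter (f : X ≃ₜ X) (n : ℤ) : X → X := ⇑(f.toEquiv ^ n)

/-- `N` is an expansive neighborhood for `f`: a closed neighborhood of the
diagonal such that any two distinct points are eventually separated by `F = f × f`. -/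
def IsExpansiveNbhd (f : X ≃ₜ X) (N : Set (X × X)) : Prop :=
  IsClosed N ∧ N ∈ nhdsSet (Set.diagonal X) ∧
    ∀ x y : X, x ≠ y → ∃ n : ℤ, (iter f n x, iter f n y) ∉ N

/-- `f` is topologically expansive. -/
def TopExpansive (f : X ≃ₜ X) : Prop := ∃ N : Set (X × X), IsExpansiveNbhd f N

/-- A `D`-pseudo-orbit: a bi-infinite sequence with `(f x_{i-1}, x_i) ∈ D`. -/
def IsPseudoOrbit (f : X ≃ₜ X) (D : Set (X × X)) (x : ℤ → X) : Prop :=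
  ∀ i : ℤ, (f (x (i - 1)), x i) ∈ D

/-- `y` `E`-traces the bi-infinite sequence `x`. -/
def Traces (f : X ≃ₜ X) (E : Set (X × X)) (y : X) (x : ℤ → X) : Prop :=
  ∀ i : ℤ, (iter f i y, x i) ∈ E

/-- `f` has the topological shadowing property. -/
def TopShadowing (f : X ≃ₜ X) : Prop :=
  ∀ E ∈ nhdsSet (Set.diagonal X), ∃ D ∈ nhdsSet (Set.diagonal X),
    ∀ x : ℤ → X, IsPseudoOrbit f D x → ∃ y : X, Traces f E y x

/-- `f` is topologically Anosov: expansive with the shadowing property. -/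
def TopAnosov (f : X ≃ₜ X) : Prop := TopExpansive f ∧ TopShadowing f

/-- An `A`-chain from `x` to `y` (of length `n ≥ 1`). -/
def IsChainFromTo (f : X ≃ₜ X) (A : Set (X × X)) (x y : X) : Prop :=
  ∃ n : ℕ, 1 ≤ n ∧ ∃ c : ℕ → X, c 0 = x ∧ c n = y ∧
    ∀ i : ℕ, 1 ≤ i → i ≤ n → (f (c (i - 1)), c i) ∈ A

/-- `x ∼ y`: for every neighborhood `A` of the diagonal there is an `A`-chain
from `x` to `y` and one from `y` to `x`. -/
def ChainRel (f : X ≃ₜ X) (x y : X) : Prop :=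
  ∀ A ∈ nhdsSet (Set.diagonal X), IsChainFromTo f A x y ∧ IsChainFromTo f A y x

/-- The chain recurrent set. -/
def CR (f : X ≃ₜ X) : Set X := {x | ChainRel f x x}

/-- `R` is a chain component: an equivalence class of `∼` restricted to `CR f`. -/
def IsChainComponent (f : X ≃ₜ X) (R : Set X) : Prop :=
  ∃ x ∈ CR f, R = {y | y ∈ CR f ∧ ChainRel f x y}

/-- The non-wandering set of `f`. -/
def NonWandering (f : X ≃ₜ X) : Set X :=
  {x | ∀ G : Set X, IsOpen G → x ∈ G → ∃ n : ℕ, 0 < n ∧ (iter f n '' G ∩ G).Nonempty}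

/-- `x` is a periodic point of `f`. -/
def Periodic (f : X ≃ₜ X) (x : X) : Prop := ∃ n : ℕ, 0 < n ∧ iter f n x = x

/-- The set of periodic points of `f`. -/
def Per (f : X ≃ₜ X) : Set X := {x | Periodic f x}

/-- A relation `M ⊆ X × X` is proper if `M[S]` is compact for every compact `S`. -/
def IsProperRel (M : Set (X × X)) : Prop :=
  ∀ S : Set X, IsCompact S → IsCompact {y : X | ∃ x ∈ S, (x, y) ∈ M}

/-- A set `U ⊆ X × X` is wide if `U ∪ (S × X) = X × X` for some compact `S`. -/
def IsWide (U : Set (X × X)) : Prop :=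
  ∃ S : Set X, IsCompact S ∧ U ∪ (S ×ˢ (Set.univ : Set X)) = Set.univ

/-- `E` is symmetric. -/
def SymmRel (E : Set (X × X)) : Prop := ∀ p : X × X, p ∈ E → (p.2, p.1) ∈ E

/-- `E² = {(x,y) : ∃ z, (x,z) ∈ E ∧ (z,y) ∈ E}`. -/
def sq (E : Set (X × X)) : Set (X × X) := {p : X × X | ∃ z : X, (p.1, z) ∈ E ∧ (z, p.2) ∈ E}

/-- The local stable set of `x` relative to `B`. -/
def WsLoc (f : X ≃ₜ X) (B : Set (X × X)) (x : X) : Set X :=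
  {y | ∀ i : ℤ, 0 ≤ i → (iter f i x, iter f i y) ∈ B}

/-- The local unstable set of `x` relative to `B`. -/
def WuLoc (f : X ≃ₜ X) (B : Set (X × X)) (x : X) : Set X :=
  {y | ∀ i : ℤ, i ≤ 0 → (iter f i x, iter f i y) ∈ B}

/-- The stable set of `x`. -/
def Ws (f : X ≃ₜ X) (x : X) : Set X :=
  {y | ∀ B ∈ nhdsSet (Set.diagonal X), ∃ n : ℕ, ∀ i : ℤ, (n : ℤ) ≤ i →
    (iter f i x, iter f i y) ∈ B}

/-- The unstable set of `x`. -/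
def Wu (f : X ≃ₜ X) (x : X) : Set X :=
  {y | ∀ B ∈ nhdsSet (Set.diagonal X), ∃ n : ℕ, ∀ i : ℤ, i ≤ -(n : ℤ) →
    (iter f i x, iter f i y) ∈ B}

/-- `f` restricted to `R` is topologically transitive: for any nonempty
relatively open subsets `G, H` of `R` there is `n ∈ ℕ` with `f^n(G) ∩ H ≠ ∅`. -/
def TransitiveOn (f : X ≃ₜ X) (R : Set X) : Prop :=
  ∀ G H : Set X, (∃ U : Set X, IsOpen U ∧ G = U ∩ R) → (∃ V : Set X, IsOpen V ∧ H = V ∩ R) →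
    G.Nonempty → H.Nonempty → ∃ n : ℕ, (iter f n '' G ∩ H).Nonempty

/-- `V_N(A)`: pairs whose first `N` forward and backward iterates all lie in `A`. -/
def VN (f : X ≃ₜ X) (A : Set (X × X)) (N : ℕ) : Set (X × X) :=
  {p : X × X | ∀ n : ℤ, |n| ≤ (N : ℤ) → (iter f n p.1, iter f n p.2) ∈ A}

/-- The `n`-th power (n ∈ ℕ) of a homeomorphism. -/
def hpowNat (f : X ≃ₜ X) : ℕ → X ≃ₜ X
  | 0 => Homeomorph.refl X
  | n + 1 => (hpowNat f n).trans f

/-- The `k`-th power (k ∈ ℤ) of a homeomorphism, as a homeomorphism. -/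
def hpow (f : X ≃ₜ X) : ℤ → X ≃ₜ X
  | Int.ofNat n => hpowNat f n
  | Int.negSucc n => (hpowNat f (n + 1)).symm

end Defs

end TopAnosovPaper

open TopAnosovPaper

/-- The iterates of a homeomorphism form an action of `ℤ`. -/
theorem iter_add_apply {X : Type*} [TopologicalSpace X] (f : X ≃ₜ X) (m n : ℤ) (x : X) :
    iter f (m + n) x = iter f m (iter f n x) := by
  simp [iter, zpow_add]

theorem continuous_iter {X : Type*} [TopologicalSpace X] (f : X ≃ₜ X) (n : ℤ) :
    Continuous (iter f n) := by
  induction n with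
  | zero => exact continuous_id
  | succ n ih =>
    have h : iter f (n + 1) = iter f n ∘ f := by
      funext x
      rw [iter_add_apply]
      simp only [iter, zpow_one]
      rfl
    rw [h]
    exact ih.comp f.continuous
  | pred n ih =>
    have h : iter f (-n - 1) = iter f (-n) ∘ f.symm := by
      funext x
      rw [sub_eq_add_neg, iter_add_apply]
      simp only [iter, zpow_neg_one]
      rfl
    rw [h]
    exact ih.comp f.symm.continuous

/-- The orbit of a periodic point is finite. -/
theorem finite_range_iter_of_periodic {X : Type*} [TopologicalSpace X] {f : X ≃ₜ X} {x : X}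
    (hx : Periodic f x) : (range fun i : ℤ => iter f i x).Finite := by
  obtain ⟨n, hn, hnx⟩ := hx
  have h : Function.Periodic (fun i : ℤ => iter f i x) (n : ℤ) := fun i => by
    simp only [iter_add_apply, hnx]
  rw [← h.image_Ioc (by exact_mod_cast hn) 0]
  exact (finite_Ioc _ _).image _

/-- If the orbit of `x` stays in a compact set and the pair of orbits of `x` and `y` stays in a
proper expansive neighborhood along a translation-invariant filter of times, then along that
filter it enters every neighborhood of the diagonal. -/
theorem eventually_iter_mem_of_eventually_mem_expansive {X : Type*} [TopologicalSpace X]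
    {f : X ≃ₜ X} {B : Set (X × X)} (hB : IsExpansiveNbhd f B) (hBp : IsProperRel B)
    {S : Set X} (hS : IsCompact S) {x y : X} (hxS : ∀ i : ℤ, iter f i x ∈ S)
    {l : Filter ℤ} (hl : ∀ n : ℤ, Filter.Tendsto (fun i => n + i) l l)
    (hxy : ∀ᶠ i in l, (iter f i x, iter f i y) ∈ B)
    {A : Set (X × X)} (hA : A ∈ nhdsSet (diagonal X)) :
    ∀ᶠ i in l, (iter f i x, iter f i y) ∈ A := by
  by_contra hbad
  obtain ⟨U, hUl, hUA⟩ := Filter.exists_ultrafilter_iff.2 (Filter.frequently_mem_iff_neBot.1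
    (Filter.not_eventually.1 hbad)) |>.imp fun U hU => le_inf_iff.1 hU
  have hK := hS.prod (hBp S hS)
  obtain ⟨⟨a, b⟩, -, hab⟩ := hK.ultrafilter_le_nhds
    (U.map fun i => (iter f i x, iter f i y)) (by
      rw [Filter.le_principal_iff, Ultrafilter.coe_map, Filter.mem_map]
      filter_upwards [hUl hxy] with i hi
      exact ⟨hxS i, _, hxS i, hi⟩)
  have hlim : Filter.Tendsto (fun i => (iter f i x, iter f i y)) U (𝓝 (a, b)) := hab
  have hne : a ≠ b := by
    rintro rfl
    have hAa : A ∈ 𝓝 (a, a) := mem_nhdsSet_iff_forall.1 hA _ rfl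
    obtain ⟨i, hiA, hi⟩ := ((hlim.eventually hAa).and (Filter.le_principal_iff.1 hUA)).exists
    exact hi hiA
  obtain ⟨n, hn⟩ := hB.2.2 a b hne
  refine hn (hB.1.mem_of_tendsto
    ((((continuous_iter f n).prodMap (continuous_iter f n)).tendsto (a, b)).comp hlim) ?_)
  filter_upwards [hUl ((hl n).eventually hxy)] with i hi
  simpa [iter_add_apply] using hi

/-- For a proper expansive neighborhood `B` and a periodic point `x`, the
local stable (unstable) set of `x` relative to `B` is contained in the stable
(unstable) set of `x`. -/
theorem localStable_subset_stable {X : Type*} [TopologicalSpace X]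
    [FirstCountableTopology X] [LocallyCompactSpace X] [ParacompactSpace X] [T2Space X]
    (f : X ≃ₜ X) (hf : TopExpansive f)
    (B : Set (X × X)) (hB : IsExpansiveNbhd f B) (hBp : IsProperRel B)
    (x : X) (hx : Periodic f x) :
    WsLoc f B x ⊆ Ws f x ∧ WuLoc f B x ⊆ Wu f x := by
  have hS := (finite_range_iter_of_periodic hx).isCompact
  refine ⟨fun y hy A hA => ?_, fun y hy A hA => ?_⟩
  · obtain ⟨N, hN⟩ := Filter.eventually_atTop.1 <|
      eventually_iter_mem_of_eventually_mem_expansive hB hBp hS (fun i => mem_range_self i)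
        (fun n => Filter.tendsto_atTop_add_const_left _ n Filter.tendsto_id)
        ((Filter.eventually_ge_atTop 0).mono hy) hA
    exact ⟨N.toNat, fun i hi => hN i (by omega)⟩
  · obtain ⟨N, hN⟩ := Filter.eventually_atBot.1 <|
      eventually_iter_mem_of_eventually_mem_expansive hB hBp hS (fun i => mem_range_self i)
        (fun n => Filter.tendsto_atBot_add_const_left _ n Filter.tendsto_id)
        ((Filter.eventually_le_atBot 0).mono hy) hA
    exact ⟨(-N).toNat, fun i hi => hN i (by omega)⟩
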